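/- arXiv:math/0611673 — 2 statements merged into one kernel-verified Lean document; each statement's English description precedes it below -/
import Mathlib

section
/- Let K be a field and G a finite group. Let L be a field extension of K of finite transcendence degree over K on which G acts faithfully by K-algebra automorphisms. Then there exists an intermediate field K ⊆ E ⊆ L that is stable under the action of G, on which G acts faithfully, and which satisfies trdeg_K(E) ≤ ed_K(G). (In the paper's notation, ed_K(L/L^G) ≤ ed_K(G).) -/
noncomputable section

/-- The transcendence degree of `L` over `K`: the supremum of the cardinalities of
algebraically independent subsets of `L`. -/
noncomputable def trdeg (K L : Type*) [CommRing K] [CommRing L] [Algebra K L] : Cardinal :=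
  ⨆ s : {s : Set L // AlgebraicIndependent K ((↑) : s → L)}, Cardinal.mk s.1

/-- The rational function field over `K` on variables indexed by `σ` :
the fraction field of the polynomial ring `K[x_i : i ∈ σ]`. -/
abbrev FnField (K : Type*) [Field K] (σ : Type*) : Type _ :=
  FractionRing (MvPolynomial σ K)

/-- Permutations of the variables acting on the polynomial ring by `K`-algebra
automorphisms. -/
noncomputable def permHom (K : Type*) [Field K] (σ : Type*) :
    Equiv.Perm σ →* (MvPolynomial σ K ≃ₐ[K] MvPolynomial σ K) where
  toFun e := MvPolynomial.renameEquiv K e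
  map_one' := MvPolynomial.renameEquiv_refl K
  map_mul' e f := by
    ext x
    simp [MvPolynomial.renameEquiv, Equiv.Perm.mul_apply]

/-- Permutations of the variables acting on the rational function field by
`K`-algebra automorphisms. -/
noncomputable def permGalAction (K : Type*) [Field K] (σ : Type*) :
    Equiv.Perm σ →* (FnField K σ ≃ₐ[K] FnField K σ) :=
  (IsFractionRing.fieldEquivOfAlgEquivHom K (FnField K σ)).comp (permHom K σ)

/-- The action of a group `G` on its rational function field `K(x_g : g ∈ G)` by
`K`-algebra automorphisms, permuting the variables by left translation:
`σ • x_g = x_{σg}`. -/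
noncomputable def galAction (K : Type*) [Field K] (G : Type*) [Group G] :
    G →* (FnField K G ≃ₐ[K] FnField K G) :=
  (permGalAction K G).comp (MulAction.toPermHom G G)

/-- The essential dimension of a group `G` over the field `K`:
the minimum of the transcendence degrees over `K` of the `G`-stable intermediate
subfields of the rational function field `K(x_g : g ∈ G)` on which `G` acts
faithfully. -/
noncomputable def edK (K : Type*) [Field K] (G : Type*) [Group G] : ℕ :=
  sInf { d : ℕ | ∃ E : IntermediateField K (FnField K G),
    (∀ g : G, ∀ x ∈ E, galAction K G g x ∈ E) ∧
    (∀ g : G, g ≠ 1 → ∃ x ∈ E, galAction K G g x ≠ x) ∧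
    trdeg K E = d }

/-- Algebraic independence of the elements of a finite group of automorphisms of an infinite
field: a nonzero polynomial in the variables `x_g` does not vanish on all orbits. -/
theorem exists_eval_smul_ne_zero {G L : Type*} [Group G] [Finite G] [Field L] [Infinite L]
    [MulSemiringAction G L] [FaithfulSMul G L] (f : MvPolynomial G L) (hf : f ≠ 0) :
    ∃ a : L, MvPolynomial.eval (fun g : G => g • a) f ≠ 0 := by
  classical
  let F := FixedPoints.subfield G L
  have hF : Infinite F := by
    by_contra h
    rw [not_infinite_iff_finite] at h
    have : Finite L := Module.finite_of_finite F
    exact not_finite L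
  let e := Module.finBasis F L
  have hli : LinearIndependent L (fun (g : G) (x : L) => g • x) := by
    have hinj : Function.Injective
        (fun g : G => ((MulSemiringAction.toRingHom G L g : L →+* L) : L →* L)) := by
      intro g h hgh
      exact FaithfulSMul.eq_of_smul_eq_smul (fun x : L => DFunLike.congr_fun hgh x)
    exact (linearIndependent_monoidHom L L).comp _ hinj
  have hli' : LinearIndependent L (fun (g : G) (k : Fin (Module.finrank F L)) => g • e k) := by
    have : Fintype G := Fintype.ofFinite G
    rw [Fintype.linearIndependent_iff] at hli ⊢
    intro c hc
    refine hli c (funext fun x => ?_)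
    have hx := e.sum_repr x
    simp only [Finset.sum_apply, Pi.smul_apply, Pi.zero_apply, smul_eq_mul]
    rw [← hx]
    have hsm : ∀ (g : G) (r : F) (y : L), g • (r • y) = r • (g • y) := by
      intro g r y
      rw [Subfield.smul_def, Subfield.smul_def, smul_eq_mul, smul_mul', smul_eq_mul]
      congr 1
      exact r.2 g
    simp only [Finset.smul_sum, hsm, Finset.mul_sum, mul_smul_comm]
    rw [Finset.sum_comm]
    refine Finset.sum_eq_zero fun k _ => ?_
    rw [← Finset.smul_sum]
    have := congrFun hc k
    simp only [Finset.sum_apply, Pi.smul_apply, Pi.zero_apply, smul_eq_mul] at this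
    rw [this, smul_zero]
  have hspan := span_flip_eq_top_iff_linearIndependent.mpr hli'
  let q : MvPolynomial (Fin (Module.finrank F L)) L :=
    MvPolynomial.aeval (fun g : G => ∑ k, MvPolynomial.C (g • e k) * MvPolynomial.X k) f
  have hq : ∀ c, MvPolynomial.eval c q
      = MvPolynomial.eval (fun g : G => ∑ k, (g • e k) * c k) f := by
    intro c
    simp only [q]
    rw [MvPolynomial.aeval_def, MvPolynomial.eval₂_eq_eval_map, MvPolynomial.eval_map,
      MvPolynomial.hom_eval₂]
    have h1 : (MvPolynomial.eval c).comp
        (algebraMap L (MvPolynomial (Fin (Module.finrank F L)) L)) = RingHom.id L := by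
      ext; simp
    rw [h1, MvPolynomial.eval₂_id]
    congr 1
    simp
  have hq0 : q ≠ 0 := by
    intro h0
    refine hf (MvPolynomial.funext fun y => ?_)
    obtain ⟨c, hc⟩ := (Submodule.mem_span_range_iff_exists_fun L).mp
      (hspan ▸ Submodule.mem_top (x := y))
    have h2 : (fun g : G => ∑ k, (g • e k) * c k) = y := by
      rw [← hc]
      funext g
      simp [flip, mul_comm]
    rw [← h2, ← hq, h0, map_zero, map_zero]
  obtain ⟨c, hc⟩ : ∃ c : Fin (Module.finrank F L) → F,
      MvPolynomial.eval (algebraMap F L ∘ c) q ≠ 0 := by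
    by_contra! h
    refine hq0 (MvPolynomial.funext_set _
      (fun _ ↦ Set.infinite_range_of_injective (algebraMap F L).injective) fun x hx ↦ ?_)
    obtain ⟨x, rfl⟩ := Set.range_piMap _ ▸ hx
    simpa using! h x
  refine ⟨∑ k, c k • e k, ?_⟩
  rw [hq] at hc
  convert hc using 3
  funext g
  rw [Finset.smul_sum]
  refine Finset.sum_congr rfl fun k _ => ?_
  rw [Subfield.smul_def, smul_eq_mul, smul_mul', mul_comm]
  congr 1
  exact (c k).2 g

/-- Given a domain `R` with fraction field `M`, an intermediate field `E` of `M / K` and a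
`K`-algebra homomorphism `ψ` from `R` to a field `L`, the subfield of `L` generated by the values
of those elements of `E` that are regular at the kernel of `ψ`. -/
def specializationField {K R M L : Type*} [Field K] [CommRing R] [Algebra K R] [Field M]
    [Algebra K M] [Algebra R M] [Field L] [Algebra K L] (E : IntermediateField K M)
    (ψ : R →ₐ[K] L) : IntermediateField K L :=
  IntermediateField.adjoin K
    {z | ∃ p q : R, ψ q ≠ 0 ∧ algebraMap R M p / algebraMap R M q ∈ E ∧ z = ψ p / ψ q}

open IntermediateField.algebraAdjoinAdjoin in
theorem trdeg_adjoin_eq {K L : Type*} [Field K] [Field L] [Algebra K L] (S : Set L) :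
    Algebra.trdeg K (IntermediateField.adjoin K S) = Algebra.trdeg K (Algebra.adjoin K S) := by
  have : Algebra.IsAlgebraic (Algebra.adjoin K S) (IntermediateField.adjoin K S) :=
    IsLocalization.isAlgebraic _ (nonZeroDivisors (Algebra.adjoin K S))
  rw [← trdeg_add_eq K (Algebra.adjoin K S) (A := IntermediateField.adjoin K S),
    trdeg_eq_zero (R := Algebra.adjoin K S), add_zero]

open Cardinal in
theorem lift_trdeg_specializationField_le.{w, u, v} {K : Type*} {R : Type w} {M : Type u}
    {L : Type v} [Field K] [CommRing R] [IsDomain R] [Algebra K R] [Field M]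
    [Algebra K M] [Algebra R M] [IsScalarTower K R M] [IsFractionRing R M] [Field L] [Algebra K L]
    (E : IntermediateField K M) (ψ : R →ₐ[K] L) :
    lift.{u} (Algebra.trdeg K (specializationField E ψ)) ≤ lift.{v} (Algebra.trdeg K E) := by
  let P : Ideal R := RingHom.ker ψ
  have hP : P.IsPrime := RingHom.ker_isPrime ψ
  have hι : ∀ y : P.primeCompl, IsUnit (IsScalarTower.toAlgHom K R M y) := fun y => by
    rw [isUnit_iff_ne_zero]
    simp only [IsScalarTower.coe_toAlgHom']
    rw [Ne, FaithfulSMul.algebraMap_eq_zero_iff]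
    exact fun h => y.2 (h ▸ P.zero_mem)
  have hψ : ∀ y : P.primeCompl, IsUnit (ψ y) := fun y => isUnit_iff_ne_zero.mpr y.2
  let ι : Localization.AtPrime P →ₐ[K] M := IsLocalization.liftAlgHom hι
  let ψ' : Localization.AtPrime P →ₐ[K] L := IsLocalization.liftAlgHom hψ
  have hιinj : Function.Injective ι := by
    refine (IsLocalization.lift_injective_iff (M := P.primeCompl) hι).mpr fun x y => ?_
    rw [(IsLocalization.injective _ P.primeCompl_le_nonZeroDivisors).eq_iff]
    exact (IsFractionRing.injective R M).eq_iff.symm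
  let A : Subalgebra K (Localization.AtPrime P) := E.toSubalgebra.comap ι
  let B : Subalgebra K L := A.map ψ'
  have hBE : lift.{u} (Algebra.trdeg K B) ≤ lift.{v} (Algebra.trdeg K E) := by
    have hAE : lift.{u} (Algebra.trdeg K A) ≤ lift.{w} (Algebra.trdeg K E) :=
      lift_trdeg_le_of_injective
        ((ι.comp A.val).codRestrict E.toSubalgebra fun a => a.2)
        fun a b hab => Subtype.ext (hιinj (congrArg Subtype.val hab))
    have hBA : lift.{w} (Algebra.trdeg K B) ≤ lift.{v} (Algebra.trdeg K A) :=
      lift_trdeg_le_of_surjective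
        ((ψ'.comp A.val).codRestrict B fun a => ⟨a, a.2, rfl⟩)
        fun ⟨_, a, ha, hab⟩ => ⟨⟨a, ha⟩, Subtype.ext hab⟩
    have hBA' := lift_le.{u}.mpr hBA
    have hAE' := lift_le.{v}.mpr hAE
    refine lift_le.{w}.mp ?_
    simp only [lift_lift] at hBA' hAE' ⊢
    exact hBA'.trans hAE'
  have hle : specializationField E ψ ≤ IntermediateField.adjoin K (B : Set L) := by
    refine IntermediateField.adjoin.mono _ _ _ ?_
    rintro _ ⟨p, q, hq, hE, rfl⟩
    let y : P.primeCompl := ⟨q, hq⟩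
    refine ⟨IsLocalization.mk' _ p y, ?_, ?_⟩
    · change ι _ ∈ E
      convert hE
      exact (IsLocalization.lift_mk' ..).trans (Units.mul_inv_eq_iff_eq_mul _ |>.mpr (by
        have hq0 : algebraMap R M q ≠ 0 := (hι y).ne_zero
        simp [IsUnit.coe_liftRight, y, div_mul_cancel₀ _ hq0]))
    · exact (IsLocalization.lift_mk' ..).trans (Units.mul_inv_eq_iff_eq_mul _ |>.mpr (by
        simp [IsUnit.coe_liftRight, y, hq]))
  have htr := trdeg_adjoin_eq (K := K) (B : Set L)
  rw [Algebra.adjoin_eq] at htr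
  refine le_trans (lift_le.mpr ?_) hBE
  rw [← htr]
  exact trdeg_le_of_injective (IntermediateField.inclusion hle)
    (IntermediateField.inclusion_injective hle)

theorem trdeg_eq_algebra_trdeg (K L : Type*) [CommRing K] [CommRing L] [Algebra K L] :
    trdeg K L = Algebra.trdeg K L :=
  rfl

theorem galAction_algebraMap (K : Type*) [Field K] (G : Type*) [Group G] (g : G)
    (p : MvPolynomial G K) :
    galAction K G g (algebraMap _ _ p) = algebraMap _ _ (MvPolynomial.rename (g * ·) p) :=
  IsFractionRing.fieldEquivOfAlgEquiv_algebraMap K (FnField K G) (FnField K G) _ p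

theorem trdeg_fnField_lt_aleph0 (K σ : Type*) [Field K] [Finite σ] :
    Algebra.trdeg K (FnField K σ) < Cardinal.aleph0 := by
  have : Algebra.IsAlgebraic (MvPolynomial σ K) (FnField K σ) :=
    IsLocalization.isAlgebraic _ (nonZeroDivisors (MvPolynomial σ K))
  rw [← trdeg_add_eq K (MvPolynomial σ K) (A := FnField K σ),
    trdeg_eq_zero (R := MvPolynomial σ K), add_zero]
  exact trdeg_lt_aleph0_of_finiteType

/-- The minimum defining `edK K G` is attained. -/
theorem exists_trdeg_eq_edK (K : Type*) [Field K] (G : Type*) [Group G] [Finite G] :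
    ∃ E : IntermediateField K (FnField K G),
      (∀ g : G, ∀ x ∈ E, galAction K G g x ∈ E) ∧
      (∀ g : G, g ≠ 1 → ∃ x ∈ E, galAction K G g x ≠ x) ∧
      trdeg K E = edK K G := by
  refine Nat.sInf_mem (s := {d : ℕ | ∃ E : IntermediateField K (FnField K G),
    (∀ g : G, ∀ x ∈ E, galAction K G g x ∈ E) ∧
    (∀ g : G, g ≠ 1 → ∃ x ∈ E, galAction K G g x ≠ x) ∧ trdeg K E = d}) ?_
  obtain ⟨n, hn⟩ := Cardinal.lt_aleph0.mp (trdeg_fnField_lt_aleph0 K G)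
  refine ⟨n, ⊤, fun _ _ _ => trivial, fun g hg => ?_, ?_⟩
  · refine ⟨algebraMap (MvPolynomial G K) _ (MvPolynomial.X 1), trivial, fun h => hg ?_⟩
    rw [galAction_algebraMap, (IsFractionRing.injective (MvPolynomial G K) (FnField K G)).eq_iff] at h
    simpa using h
  · rw [trdeg_eq_algebra_trdeg, ← hn]
    exact IntermediateField.topEquiv.trdeg_eq

/-- If a finite group `G` acts faithfully by `K`-algebra automorphisms on a field
extension `L` of `K` of finite transcendence degree, then there is a `G`-stable
intermediate field `K ⊆ E ⊆ L` on which `G` acts faithfully with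
`trdeg_K(E) ≤ ed_K(G)`.  (In the paper's notation, `ed_K(L/L^G) ≤ ed_K(G)`.) -/
theorem exists_faithful_subfield_trdeg_le_edK (K : Type*) [Field K]
    (G : Type*) [Group G] [Finite G] (L : Type*) [Field L] [Algebra K L]
    (htd : trdeg K L < Cardinal.aleph0)
    (φ : G →* (L ≃ₐ[K] L)) (hφ : Function.Injective φ) :
    ∃ E : IntermediateField K L,
      (∀ g : G, ∀ x ∈ E, φ g x ∈ E) ∧
      (∀ g : G, g ≠ 1 → ∃ x ∈ E, φ g x ≠ x) ∧
      trdeg K E ≤ (edK K G : Cardinal) := by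
  classical
  obtain hL | hL := finite_or_infinite L
  · have : Finite K := Finite.of_injective _ (algebraMap K L).injective
    refine ⟨⊤, fun _ _ _ => trivial, fun g hg => ?_, ?_⟩
    · by_contra! h
      exact hg (hφ (by ext x; simpa using h x trivial))
    · rw [trdeg_eq_algebra_trdeg, trdeg_eq_zero]
      exact zero_le
  obtain ⟨E, hstab, hfaith, htr⟩ := exists_trdeg_eq_edK K G
  let : MulSemiringAction G L := MulSemiringAction.compHom L φ
  have : FaithfulSMul G L := ⟨fun h => hφ (AlgEquiv.ext h)⟩
  have hfrac : ∀ g : G, g ≠ 1 → ∃ p q : MvPolynomial G K, q ≠ 0 ∧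
      algebraMap _ (FnField K G) p / algebraMap _ (FnField K G) q ∈ E ∧
      MvPolynomial.rename (g * ·) p * q - p * MvPolynomial.rename (g * ·) q ≠ 0 := by
    intro g hg
    obtain ⟨x, hxE, hx⟩ := hfaith g hg
    obtain ⟨p, q, hq, rfl⟩ := IsFractionRing.div_surjective (A := MvPolynomial G K) x
    have hq := nonZeroDivisors.ne_zero hq
    refine ⟨p, q, hq, hxE, fun h => hx ?_⟩
    rw [map_div₀, galAction_algebraMap, galAction_algebraMap, div_eq_div_iff, ← map_mul, ← map_mul,
      sub_eq_zero.mp h]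
    · simpa using (map_ne_zero_iff _ (MvPolynomial.rename_injective _ (mul_right_injective g))).mpr hq
    · simpa using hq
  choose! p q hq hE hpq using hfrac
  have : Fintype G := Fintype.ofFinite G
  let f : MvPolynomial G K := ∏ g ∈ Finset.univ.erase (1 : G), (q g *
    (MvPolynomial.rename (g * ·) (p g) * q g - p g * MvPolynomial.rename (g * ·) (q g)))
  have hf : f ≠ 0 := Finset.prod_ne_zero_iff.mpr fun g hg =>
    mul_ne_zero (hq g (Finset.ne_of_mem_erase hg)) (hpq g (Finset.ne_of_mem_erase hg))
  obtain ⟨a, ha⟩ := exists_eval_smul_ne_zero (MvPolynomial.map (algebraMap K L) f)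
    ((map_ne_zero_iff _ (MvPolynomial.map_injective _ (algebraMap K L).injective)).mpr hf)
  let ψ : MvPolynomial G K →ₐ[K] L := MvPolynomial.aeval fun g => φ g a
  have hψ : ∀ g x, ψ (MvPolynomial.rename (g * ·) x) = φ g (ψ x) := by
    intro g x
    have : ψ.comp (MvPolynomial.rename (g * ·)) = (φ g : L →ₐ[K] L).comp ψ := by
      ext h
      simp [ψ]
    exact DFunLike.congr_fun this x
  have hψf : ψ f ≠ 0 := by
    rwa [MvPolynomial.eval_map, ← MvPolynomial.aeval_def] at ha
  rw [map_prod, Finset.prod_ne_zero_iff] at hψf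
  refine ⟨specializationField E ψ, fun g => ?_, fun g hg => ?_, ?_⟩
  · suffices specializationField E ψ ≤ (specializationField E ψ).comap (φ g : L →ₐ[K] L) from
      fun x hx => this hx
    refine IntermediateField.adjoin_le_iff.mpr ?_
    rintro _ ⟨p, q, hq, hpqE, rfl⟩
    refine IntermediateField.subset_adjoin K _ ⟨MvPolynomial.rename (g * ·) p,
      MvPolynomial.rename (g * ·) q, ?_, ?_, ?_⟩
    · simpa [hψ] using hq
    · simpa [galAction_algebraMap] using hstab g _ hpqE
    · simp [hψ]
  · have h := hψf g (Finset.mem_erase.mpr ⟨hg, Finset.mem_univ g⟩)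
    rw [map_mul, mul_ne_zero_iff, map_sub, map_mul, map_mul, hψ, hψ] at h
    refine ⟨ψ (p g) / ψ (q g), IntermediateField.subset_adjoin K _ ⟨p g, q g, h.1, hE g hg, rfl⟩,
      fun heq => h.2 ?_⟩
    rw [map_div₀, div_eq_div_iff (by simpa using h.1) h.1] at heq
    rw [heq, sub_self]
  · have h := lift_trdeg_specializationField_le E ψ
    rw [← trdeg_eq_algebra_trdeg, ← trdeg_eq_algebra_trdeg, htr, Cardinal.lift_natCast] at h
    exact Cardinal.lift_le_nat_iff.mp h
end
end

section
/- Let K be any field and n ≥ 5 an integer. Let the symmetric group S_n act on the rational function field K(x₁,…,xₙ) (the fraction field of the polynomial ring in n variables over K) by σ·x_i = x_{σ(i)}. For distinct indices i, j, k, l in {1,…,n} define the cross-ratio [i,j;k,l] = (x_i−x_k)(x_j−x_l)(x_i−x_l)^{-1}(x_j−x_k)^{-1}, and let L be the subfield of K(x₁,…,xₙ) generated over K by all cross-ratios [i,j;k,l] as i, j, k, l range over all quadruples of distinct indices. Then: (a) L is stable under the action of S_n and S_n acts faithfully on L; (b) L = K([1,2;3,i] : 4 ≤ i ≤ n); (c)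 the n−3 elements [1,2;3,i] for 4 ≤ i ≤ n are algebraically independent over K, so L is purely transcendental of transcendence degree n−3 over K. -/
noncomputable section

variable (K : Type*) [Field K]

/-- The variable `xᵢ`, viewed inside the rational function field `K(x₁,…,xₙ)`. -/
noncomputable def fnVar (n : ℕ) (i : Fin n) : FnField K (Fin n) :=
  algebraMap (MvPolynomial (Fin n) K) (FnField K (Fin n)) (MvPolynomial.X i)

/-- The cross-ratio `[i,j;k,l] = (xᵢ−x_k)(x_j−x_l)(xᵢ−x_l)⁻¹(x_j−x_k)⁻¹`. -/
noncomputable def crossRatio (n : ℕ) (i j k l : Fin n) : FnField K (Fin n) :=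
  (fnVar K n i - fnVar K n k) * (fnVar K n j - fnVar K n l) *
    (fnVar K n i - fnVar K n l)⁻¹ * (fnVar K n j - fnVar K n k)⁻¹

/-- The field of cross-ratios: the subfield of `K(x₁,…,xₙ)` generated over `K` by all
cross-ratios `[i,j;k,l]` with `i, j, k, l` distinct. -/
noncomputable def crossField (n : ℕ) : IntermediateField K (FnField K (Fin n)) :=
  IntermediateField.adjoin K
    {z | ∃ i j k l : Fin n, i ≠ j ∧ i ≠ k ∧ i ≠ l ∧ j ≠ k ∧ j ≠ l ∧ k ≠ l ∧
      z = crossRatio K n i j k l}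

/-- A field generated by `S` is algebraic over the subalgebra generated by `S`. -/
theorem isAlgebraic_of_intermediateField_adjoin_eq_top {K E : Type*} [Field K] [Field E]
    [Algebra K E] {S : Set E} (h : IntermediateField.adjoin K S = ⊤) :
    Algebra.IsAlgebraic (Algebra.adjoin K S) E := by
  refine ⟨fun x => ?_⟩
  have hx : x ∈ IntermediateField.adjoin K S := h ▸ IntermediateField.mem_top
  obtain ⟨r, hr, s, hs, rfl⟩ := IntermediateField.mem_adjoin_iff_div.mp hx
  rw [div_eq_mul_inv]
  exact (isAlgebraic_algebraMap (⟨r, hr⟩ : Algebra.adjoin K S)).mul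
    (isAlgebraic_algebraMap (⟨s, hs⟩ : Algebra.adjoin K S)).inv

/-- The field generated by an algebraically independent family has transcendence degree
the cardinality of the family. -/
theorem trdeg_adjoin_range_of_algebraicIndependent {K E : Type*} {ι : Type} [Field K] [Field E]
    [Algebra K E] [Fintype ι] {f : ι → E} (hf : AlgebraicIndependent K f) :
    trdeg K (IntermediateField.adjoin K (Set.range f)) = (Fintype.card ι : ℕ) := by
  set L := IntermediateField.adjoin K (Set.range f)
  let f' : ι → L := fun i => ⟨f i, IntermediateField.subset_adjoin K _ ⟨i, rfl⟩⟩
  have hf' : AlgebraicIndependent K f' := AlgebraicIndependent.of_comp L.val hf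
  have htop : IntermediateField.adjoin K (Set.range f') = ⊤ := by
    apply IntermediateField.map_injective L.val
    rw [IntermediateField.adjoin_map, ← Set.range_comp, ← AlgHom.fieldRange_eq_map,
      IntermediateField.fieldRange_val]
    rfl
  have halg := isAlgebraic_of_intermediateField_adjoin_eq_top htop
  have hb : IsTranscendenceBasis K f' := hf'.isTranscendenceBasis_iff_isAlgebraic.mpr halg
  have h := hb.lift_cardinalMk_eq_trdeg
  rw [Cardinal.mk_fintype, Cardinal.lift_natCast, Cardinal.lift_uzero] at h
  exact h.symm

/-- The transcendence degree of `K(x₁,…,xₙ)` is `n`. -/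
theorem trdeg_fnField (n : ℕ) : Algebra.trdeg K (FnField K (Fin n)) = n := by
  have := IsLocalization.isAlgebraic (S := FnField K (Fin n))
    (nonZeroDivisors (MvPolynomial (Fin n) K))
  have hb := (IsTranscendenceBasis.mvPolynomial (Fin n) K).algebraMap_comp
    (A := FnField K (Fin n))
  have h := hb.lift_cardinalMk_eq_trdeg
  rw [Cardinal.mk_fintype, Cardinal.lift_natCast, Cardinal.lift_uzero] at h
  simpa using h.symm

theorem fnVar_injective (n : ℕ) : Function.Injective (fnVar K n) :=
  (IsFractionRing.injective (MvPolynomial (Fin n) K) (FnField K (Fin n))).comp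
    (MvPolynomial.X_injective)

theorem fnVar_sub_ne_zero {n : ℕ} {i j : Fin n} (h : i ≠ j) : fnVar K n i - fnVar K n j ≠ 0 :=
  sub_ne_zero.mpr ((fnVar_injective K n).ne h)

theorem permGalAction_fnVar {n : ℕ} (g : Equiv.Perm (Fin n)) (i : Fin n) :
    permGalAction K (Fin n) g (fnVar K n i) = fnVar K n (g i) := by
  simp [permGalAction, fnVar, permHom, IsFractionRing.fieldEquivOfAlgEquivHom_apply]

theorem permGalAction_crossRatio {n : ℕ} (g : Equiv.Perm (Fin n)) (i j k l : Fin n) :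
    permGalAction K (Fin n) g (crossRatio K n i j k l) =
      crossRatio K n (g i) (g j) (g k) (g l) := by
  simp [crossRatio, permGalAction_fnVar]

theorem adjoin_range_fnVar (n : ℕ) :
    IntermediateField.adjoin K (Set.range (fnVar K n)) = ⊤ := by
  rw [eq_top_iff]
  have hpoly (p : MvPolynomial (Fin n) K) : algebraMap _ (FnField K (Fin n)) p ∈
      IntermediateField.adjoin K (Set.range (fnVar K n)) := by
    induction p using MvPolynomial.induction_on with
    | C a =>
      rw [← MvPolynomial.algebraMap_eq, ← IsScalarTower.algebraMap_apply]
      exact IntermediateField.algebraMap_mem _ a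
    | add p q hp hq => rw [map_add]; exact add_mem hp hq
    | mul_X p i hp =>
      rw [map_mul]
      exact mul_mem hp (IntermediateField.subset_adjoin K _ ⟨i, rfl⟩)
  intro z _
  obtain ⟨p, q, _, rfl⟩ := IsFractionRing.div_surjective (A := MvPolynomial (Fin n) K) z
  exact div_mem (hpoly p) (hpoly q)

theorem crossRatio_mem_crossField {n : ℕ} {i j k l : Fin n} (hij : i ≠ j) (hik : i ≠ k)
    (hil : i ≠ l) (hjk : j ≠ k) (hjl : j ≠ l) (hkl : k ≠ l) :
    crossRatio K n i j k l ∈ crossField K n :=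
  IntermediateField.subset_adjoin K _ ⟨i, j, k, l, hij, hik, hil, hjk, hjl, hkl, rfl⟩

theorem permGalAction_mem_crossField {n : ℕ} (g : Equiv.Perm (Fin n)) {x : FnField K (Fin n)}
    (hx : x ∈ crossField K n) : permGalAction K (Fin n) g x ∈ crossField K n := by
  suffices h : crossField K n ≤ (crossField K n).comap
      (permGalAction K (Fin n) g : FnField K (Fin n) →ₐ[K] FnField K (Fin n)) from h hx
  refine IntermediateField.adjoin_le_iff.mpr ?_
  rintro _ ⟨i, j, k, l, hij, hik, hil, hjk, hjl, hkl, rfl⟩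
  change permGalAction K (Fin n) g _ ∈ crossField K n
  rw [permGalAction_crossRatio]
  apply crossRatio_mem_crossField <;> rwa [g.injective.ne_iff]

/-- Equal cross-ratios `[i,j;k,l] = [p,q;r,s]` force `{i,k} = {p,r}` or `{i,k} = {q,s}`. -/
theorem eq_pair_of_crossRatio_eq {n : ℕ} {i j k l p q r s : Fin n}
    (hij : i ≠ j) (hil : i ≠ l) (hjk : j ≠ k) (hkl : k ≠ l)
    (hps : p ≠ s) (hqr : q ≠ r) (hpr : p ≠ r) (hqs : q ≠ s)
    (h : crossRatio K n i j k l = crossRatio K n p q r s) :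
    (p = i ∧ r = k ∨ p = k ∧ r = i) ∨ (q = i ∧ s = k ∨ q = k ∧ s = i) := by
  have hil' := fnVar_sub_ne_zero K hil
  have hjk' := fnVar_sub_ne_zero K hjk
  have hps' := fnVar_sub_ne_zero K hps
  have hqr' := fnVar_sub_ne_zero K hqr
  have hF : (fnVar K n i - fnVar K n k) * (fnVar K n j - fnVar K n l) *
      ((fnVar K n p - fnVar K n s) * (fnVar K n q - fnVar K n r)) =
      (fnVar K n p - fnVar K n r) * (fnVar K n q - fnVar K n s) *
      ((fnVar K n i - fnVar K n l) * (fnVar K n j - fnVar K n k)) := by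
    unfold crossRatio at h
    field_simp at h
    linear_combination h
  have hP : (MvPolynomial.X i - MvPolynomial.X k : MvPolynomial (Fin n) K) *
      (MvPolynomial.X j - MvPolynomial.X l) *
      ((MvPolynomial.X p - MvPolynomial.X s) * (MvPolynomial.X q - MvPolynomial.X r)) =
      (MvPolynomial.X p - MvPolynomial.X r) * (MvPolynomial.X q - MvPolynomial.X s) *
      ((MvPolynomial.X i - MvPolynomial.X l) * (MvPolynomial.X j - MvPolynomial.X k)) := by
    apply IsFractionRing.injective (MvPolynomial (Fin n) K) (FnField K (Fin n))
    simpa only [map_mul, map_sub, fnVar] using hF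
  let c : Fin n → Fin n := fun m => if m = k then i else m
  have hc {a b : Fin n} (hab : a ≠ b) (h : c a = c b) : a = i ∧ b = k ∨ a = k ∧ b = i := by
    grind
  have hE := congrArg (MvPolynomial.rename c) hP
  simp only [map_mul, map_sub, MvPolynomial.rename_X] at hE
  rw [show c i = c k by grind, sub_self, zero_mul, zero_mul, eq_comm] at hE
  simp only [mul_eq_zero, sub_eq_zero, (MvPolynomial.X_injective (R := K)).eq_iff] at hE
  rcases hE with (h | h) | h | h
  · exact .inl (hc hpr h)
  · exact .inr (hc hqs h)
  · grind
  · grind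

theorem exists_crossRatio_ne {n : ℕ} (hn : 5 ≤ n) {g : Equiv.Perm (Fin n)} (hg : g ≠ 1) :
    ∃ x ∈ crossField K n, permGalAction K (Fin n) g x ≠ x := by
  obtain ⟨i, hi⟩ : ∃ i, g i ≠ i := by
    by_contra! h
    exact hg (Equiv.ext h)
  have avoid (s : Finset (Fin n)) (hs : s.card < n) : ∃ x, x ∉ s := by
    by_contra! h
    rw [Finset.eq_univ_iff_forall.mpr h, Finset.card_univ, Fintype.card_fin] at hs
    exact hs.false
  obtain ⟨k, hk⟩ := avoid {i, g i} (Finset.card_le_two.trans_lt (by omega))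
  obtain ⟨j, hj⟩ := avoid {i, k, g⁻¹ i, g⁻¹ k} (Finset.card_le_four.trans_lt (by omega))
  obtain ⟨l, hl⟩ := avoid {i, j, k} (Finset.card_le_three.trans_lt (by omega))
  simp only [Finset.mem_insert, Finset.mem_singleton, not_or, Equiv.Perm.eq_inv_iff_eq]
    at hk hj hl
  obtain ⟨hki, hkg⟩ := hk
  obtain ⟨hji, hjk, hgji, hgjk⟩ := hj
  obtain ⟨hli, hlj, hlk⟩ := hl
  refine ⟨crossRatio K n i j k l, crossRatio_mem_crossField K (Ne.symm hji) (Ne.symm hki)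
    (Ne.symm hli) hjk (Ne.symm hlj) (Ne.symm hlk), fun h => ?_⟩
  rw [permGalAction_crossRatio] at h
  have hinj {a b : Fin n} (hab : a ≠ b) : g a ≠ g b := g.injective.ne hab
  rcases eq_pair_of_crossRatio_eq K (Ne.symm hji) (Ne.symm hli) hjk (Ne.symm hlk)
    (hinj (Ne.symm hli)) (hinj hjk) (hinj (Ne.symm hki)) (hinj (Ne.symm hlj)) h.symm
    with (⟨h, -⟩ | ⟨h, -⟩) | ⟨h, -⟩ | ⟨h, -⟩
  · exact hi h
  · exact hkg h.symm
  · exact hgji h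
  · exact hgjk h

theorem crossRatio_sub_crossRatio {n : ℕ} {a b c u v : Fin n} (hbc : b ≠ c)
    (hu : u ≠ a) (hv : v ≠ a) :
    crossRatio K n a b c u - crossRatio K n a b c v =
      (fnVar K n a - fnVar K n c) * (fnVar K n a - fnVar K n b) / (fnVar K n b - fnVar K n c) *
      ((fnVar K n v - fnVar K n u) /
        ((fnVar K n a - fnVar K n u) * (fnVar K n a - fnVar K n v))) := by
  have hbc' := fnVar_sub_ne_zero K hbc
  have hu' := fnVar_sub_ne_zero K hu.symm
  have hv' := fnVar_sub_ne_zero K hv.symm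
  unfold crossRatio
  field_simp
  ring

/-- The cross-ratio of four points in terms of the coordinates `[a,b;c,·]`. -/
theorem crossRatio_eq_of_ne {n : ℕ} {a b c i j k l : Fin n} (hab : a ≠ b) (hac : a ≠ c)
    (hbc : b ≠ c) (hi : i ≠ a) (hj : j ≠ a) (hk : k ≠ a) (hl : l ≠ a) (hil : i ≠ l)
    (hjk : j ≠ k) :
    crossRatio K n i j k l =
      (crossRatio K n a b c i - crossRatio K n a b c k) *
      (crossRatio K n a b c j - crossRatio K n a b c l) *
      (crossRatio K n a b c i - crossRatio K n a b c l)⁻¹ *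
      (crossRatio K n a b c j - crossRatio K n a b c k)⁻¹ := by
  have hac' := fnVar_sub_ne_zero K hac
  have hab' := fnVar_sub_ne_zero K hab
  have hbc' := fnVar_sub_ne_zero K hbc
  rw [crossRatio_sub_crossRatio K hbc hi hk, crossRatio_sub_crossRatio K hbc hj hl,
    crossRatio_sub_crossRatio K hbc hi hl, crossRatio_sub_crossRatio K hbc hj hk]
  have hi' := fnVar_sub_ne_zero K hi.symm
  have hj' := fnVar_sub_ne_zero K hj.symm
  have hk' := fnVar_sub_ne_zero K hk.symm
  have hl' := fnVar_sub_ne_zero K hl.symm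
  have hli := fnVar_sub_ne_zero K hil.symm
  have hkj := fnVar_sub_ne_zero K hjk.symm
  have hil' := fnVar_sub_ne_zero K hil
  have hjk' := fnVar_sub_ne_zero K hjk
  unfold crossRatio
  field_simp
  ring

/-- The cross-ratio of `a` and three more points in terms of the coordinates `[a,b;c,·]`. -/
theorem crossRatio_left_eq {n : ℕ} {a b c j k l : Fin n} (hab : a ≠ b) (hac : a ≠ c)
    (hbc : b ≠ c) (hj : j ≠ a) (hk : k ≠ a) (hl : l ≠ a) (hjk : j ≠ k) :
    crossRatio K n a j k l =
      (crossRatio K n a b c j - crossRatio K n a b c l) *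
      (crossRatio K n a b c j - crossRatio K n a b c k)⁻¹ := by
  have hac' := fnVar_sub_ne_zero K hac
  have hab' := fnVar_sub_ne_zero K hab
  have hbc' := fnVar_sub_ne_zero K hbc
  rw [crossRatio_sub_crossRatio K hbc hj hl, crossRatio_sub_crossRatio K hbc hj hk]
  have hj' := fnVar_sub_ne_zero K hj.symm
  have hk' := fnVar_sub_ne_zero K hk.symm
  have hl' := fnVar_sub_ne_zero K hl.symm
  have hkj := fnVar_sub_ne_zero K hjk.symm
  have hjk' := fnVar_sub_ne_zero K hjk
  unfold crossRatio
  field_simp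
  ring

theorem crossRatio_swap_pairs {n : ℕ} (i j k l : Fin n) :
    crossRatio K n k l i j = crossRatio K n i j k l := by
  unfold crossRatio
  rw [← neg_sub (fnVar K n i) (fnVar K n k), ← neg_sub (fnVar K n j) (fnVar K n l),
    ← neg_sub (fnVar K n j) (fnVar K n k), ← neg_sub (fnVar K n i) (fnVar K n l),
    inv_neg, inv_neg]
  ring

theorem crossRatio_swap_both {n : ℕ} (i j k l : Fin n) :
    crossRatio K n j i l k = crossRatio K n i j k l := by
  unfold crossRatio
  ring

/-- The field of cross-ratios is generated by the coordinates `[a,b;c,i]`. -/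
theorem crossField_eq_adjoin {n : ℕ} {a b c : Fin n} (hab : a ≠ b) (hac : a ≠ c)
    (hbc : b ≠ c) {s : Fin n → Prop} (hs : ∀ i, s i ↔ i ≠ a ∧ i ≠ b ∧ i ≠ c) :
    crossField K n = IntermediateField.adjoin K
      (Set.range fun i : {i // s i} => crossRatio K n a b c i) := by
  apply le_antisymm
  · set M := IntermediateField.adjoin K
      (Set.range fun i : {i // s i} => crossRatio K n a b c i)
    have ht {i : Fin n} (hi : i ≠ a) : crossRatio K n a b c i ∈ M := by
      rcases eq_or_ne i b with rfl | hib
      · simp [crossRatio]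
      rcases eq_or_ne i c with rfl | hic
      · have h1 := fnVar_sub_ne_zero K hac
        have h2 := fnVar_sub_ne_zero K hbc
        have h : crossRatio K n a b i i = 1 := by
          unfold crossRatio
          field_simp
        exact h ▸ one_mem M
      · exact IntermediateField.subset_adjoin K _ ⟨⟨i, (hs i).mpr ⟨hi, hib, hic⟩⟩, rfl⟩
    have hsub {i j : Fin n} (hi : i ≠ a) (hj : j ≠ a) :
        crossRatio K n a b c i - crossRatio K n a b c j ∈ M := sub_mem (ht hi) (ht hj)
    have hleft {j k l : Fin n} (hj : j ≠ a) (hk : k ≠ a) (hl : l ≠ a) (hjk : j ≠ k) :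
        crossRatio K n a j k l ∈ M := by
      rw [crossRatio_left_eq K hab hac hbc hj hk hl hjk]
      exact mul_mem (hsub hj hl) (inv_mem (hsub hj hk))
    refine IntermediateField.adjoin_le_iff.mpr ?_
    rintro _ ⟨i, j, k, l, hij, hik, hil, hjk, hjl, hkl, rfl⟩
    change _ ∈ M
    rcases eq_or_ne i a with rfl | hi
    · exact hleft hij.symm hik.symm hil.symm hjk
    rcases eq_or_ne j a with rfl | hj
    · rw [← crossRatio_swap_both]
      exact hleft hi hjl.symm hjk.symm hil
    rcases eq_or_ne k a with rfl | hk
    · rw [← crossRatio_swap_pairs]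
      exact hleft hkl.symm hi hj hil.symm
    rcases eq_or_ne l a with rfl | hl
    · rw [← crossRatio_swap_pairs, ← crossRatio_swap_both]
      exact hleft hk hj hi hjk.symm
    rw [crossRatio_eq_of_ne K hab hac hbc hi hj hk hl hil hjk]
    exact mul_mem (mul_mem (mul_mem (hsub hi hk) (hsub hj hl)) (inv_mem (hsub hi hl)))
      (inv_mem (hsub hj hk))
  · refine IntermediateField.adjoin_le_iff.mpr ?_
    rintro _ ⟨⟨i, hi⟩, rfl⟩
    obtain ⟨hia, hib, hic⟩ := (hs i).mp hi
    exact crossRatio_mem_crossField K hab hac hia.symm hbc hib.symm hic.symm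

/-- The variable `xᵢ` recovered from `x_a`, `x_b`, `x_c` and `[a,b;c,i]`. -/
theorem fnVar_eq_of_crossRatio {n : ℕ} {a b c i : Fin n} (hab : a ≠ b) (hac : a ≠ c)
    (hbc : b ≠ c) (hi : i ≠ a) :
    fnVar K n i =
      ((fnVar K n a - fnVar K n c) * fnVar K n b -
        crossRatio K n a b c i * fnVar K n a * (fnVar K n b - fnVar K n c)) /
      ((fnVar K n a - fnVar K n c) - crossRatio K n a b c i * (fnVar K n b - fnVar K n c)) := by
  have hab' := fnVar_sub_ne_zero K hab
  have hac' := fnVar_sub_ne_zero K hac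
  have hbc' := fnVar_sub_ne_zero K hbc
  have hi' := fnVar_sub_ne_zero K hi.symm
  have hden : (fnVar K n a - fnVar K n c) -
      crossRatio K n a b c i * (fnVar K n b - fnVar K n c) =
      (fnVar K n a - fnVar K n c) * (fnVar K n a - fnVar K n b) /
        (fnVar K n a - fnVar K n i) := by
    unfold crossRatio
    field_simp
    ring
  rw [hden, eq_div_iff (by positivity)]
  unfold crossRatio
  field_simp
  ring

theorem algebraicIndependent_crossRatio {n : ℕ} {a b c : Fin n} (hab : a ≠ b) (hac : a ≠ c)
    (hbc : b ≠ c) {s : Fin n → Prop} (hs : ∀ i, s i ↔ i ≠ a ∧ i ≠ b ∧ i ≠ c) :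
    AlgebraicIndependent K (fun i : {i // s i} => crossRatio K n a b c i) := by
  classical
  let y : Fin n → FnField K (Fin n) := fun i =>
    if s i then crossRatio K n a b c i else fnVar K n i
  have hy (i : Fin n) : y i ∈ IntermediateField.adjoin K (Set.range y) :=
    IntermediateField.subset_adjoin K _ ⟨i, rfl⟩
  have hvar {i : Fin n} (hi : ¬ s i) :
      fnVar K n i ∈ IntermediateField.adjoin K (Set.range y) := by
    simpa [y, hi] using hy i
  have ha := hvar (i := a) (by simp [hs])
  have hb := hvar (i := b) (by simp [hs])
  have hc := hvar (i := c) (by simp [hs])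
  have htop : IntermediateField.adjoin K (Set.range y) = ⊤ := by
    rw [eq_top_iff, ← adjoin_range_fnVar, IntermediateField.adjoin_le_iff]
    rintro _ ⟨i, rfl⟩
    by_cases hi : s i
    · have hr : crossRatio K n a b c i ∈ IntermediateField.adjoin K (Set.range y) := by
        simpa [y, hi] using hy i
      rw [fnVar_eq_of_crossRatio K hab hac hbc ((hs i).mp hi).1]
      exact div_mem
        (sub_mem (mul_mem (sub_mem ha hc) hb) (mul_mem (mul_mem hr ha) (sub_mem hb hc)))
        (sub_mem (sub_mem ha hc) (mul_mem hr (sub_mem hb hc)))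
    · exact hvar hi
  have halg := isAlgebraic_of_intermediateField_adjoin_eq_top htop
  have hbasis : IsTranscendenceBasis K y :=
    Algebra.IsAlgebraic.isTranscendenceBasis_of_lift_le_trdeg_of_finite K y
      (by simp [trdeg_fnField])
  convert hbasis.1.comp _ (Subtype.val_injective (p := s)) using 1
  funext i
  simp [y, i.2]

/-- For `n ≥ 5` and an arbitrary field `K`: (a) the field of cross-ratios `L` is stable
under the `Sₙ`-action on `K(x₁,…,xₙ)` and `Sₙ` acts faithfully on it;
(b) `L = K([1,2;3,i] : 4 ≤ i ≤ n)` (with `0`-based indexing, `L` is generated by the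
cross-ratios `[x₀,x₁;x₂,xᵢ]`, `3 ≤ i`); (c) these `n − 3` generators are algebraically
independent over `K`, and `L` is purely transcendental of transcendence degree `n − 3`
over `K`. -/
theorem crossField_stable_faithful_purelyTranscendental (n : ℕ) (hn : 5 ≤ n) :
    (∀ g : Equiv.Perm (Fin n), ∀ x ∈ crossField K n, permGalAction K (Fin n) g x ∈ crossField K n) ∧
    (∀ g : Equiv.Perm (Fin n), g ≠ 1 → ∃ x ∈ crossField K n, permGalAction K (Fin n) g x ≠ x) ∧
    crossField K n = IntermediateField.adjoin K
      (Set.range fun i : {i : Fin n // 3 ≤ (i : ℕ)} =>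
        crossRatio K n ⟨0, by omega⟩ ⟨1, by omega⟩ ⟨2, by omega⟩ i) ∧
    AlgebraicIndependent K
      (fun i : {i : Fin n // 3 ≤ (i : ℕ)} =>
        crossRatio K n ⟨0, by omega⟩ ⟨1, by omega⟩ ⟨2, by omega⟩ i) ∧
    trdeg K (crossField K n) = (n - 3 : ℕ) := by
  have h01 : (⟨0, by omega⟩ : Fin n) ≠ ⟨1, by omega⟩ := by simp
  have h02 : (⟨0, by omega⟩ : Fin n) ≠ ⟨2, by omega⟩ := by simp
  have h12 : (⟨1, by omega⟩ : Fin n) ≠ ⟨2, by omega⟩ := by simp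
  have hs (i : Fin n) : 3 ≤ (i : ℕ) ↔
      i ≠ ⟨0, by omega⟩ ∧ i ≠ ⟨1, by omega⟩ ∧ i ≠ ⟨2, by omega⟩ := by
    simp only [ne_eq, Fin.ext_iff]
    omega
  have hgen := crossField_eq_adjoin K h01 h02 h12 hs
  have hind := algebraicIndependent_crossRatio K h01 h02 h12 hs
  refine ⟨fun g x hx => permGalAction_mem_crossField K g hx,
    fun g hg => exists_crossRatio_ne K hn hg, hgen, hind, ?_⟩
  rw [hgen, trdeg_adjoin_range_of_algebraicIndependent hind]
  have hcard : Fintype.card {i : Fin n // 3 ≤ (i : ℕ)} = n - 3 := by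
    rw [Fintype.card_subtype, show (Finset.univ.filter fun i : Fin n => 3 ≤ (i : ℕ)) =
      Finset.Ici (⟨3, by omega⟩ : Fin n) by ext i; simp [Fin.le_def], Fin.card_Ici]
  rw [hcard]
end
end
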